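/- Mon(ω,𝒢) has enough injectives: for every object (g1: G1 → G0) of Mon(ω,𝒢) there exist finitely generated projective S-modules Q1, Q0 and a morphism φ = (φ1,φ0): (g1: G1 → G0) → (ω ⊕ id_{Q0}: Q1 ⊕ Q0 → Q1 ⊕ Q0) in Mon(ω,𝒢) such that φ1 and φ0 are injective and the induced map on componentwise cokernels is an object of Mon(ω,𝒢); that is, φ is an admissible monic into an injective object. -/

import Mathlib

open CategoryTheory LinearMap Function

/-- A module `M` over a commutative ring `A` is *Gorenstein projective* if the biduality
map `M → Hom_A(Hom_A(M,A),A)` is an isomorphism and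
`Ext^i_A(M,A) = 0 = Ext^i_A(Hom_A(M,A),A)` for all `i ≥ 1`. -/
noncomputable def IsGP (A : Type) [CommRing A] (M : Type) [AddCommGroup M] [Module A M] : Prop :=
  Function.Bijective (Module.Dual.eval A M) ∧
  (∀ i : ℕ, 0 < i →
    Subsingleton (((Ext A (ModuleCat A) i).obj
      (Opposite.op (ModuleCat.of A M))).obj (ModuleCat.of A A))) ∧
  (∀ i : ℕ, 0 < i →
    Subsingleton (((Ext A (ModuleCat A) i).obj
      (Opposite.op (ModuleCat.of A (Module.Dual A M)))).obj (ModuleCat.of A A)))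

/-- `f : G1 → G0` is an object of the monomorphism category `Mon(ω, 𝒢)`:
`G1`, `G0` are finitely generated Gorenstein projective `S`-modules, `f` is injective,
and `ω · Coker f = 0` (i.e. `ω • y ∈ range f` for all `y`). -/
def MonObj (S : Type) [CommRing S] (ω : S) {G1 G0 : Type}
    [AddCommGroup G1] [Module S G1] [AddCommGroup G0] [Module S G0]
    (f : G1 →ₗ[S] G0) : Prop :=
  Module.Finite S G1 ∧ Module.Finite S G0 ∧ IsGP S G1 ∧ IsGP S G0 ∧
  Function.Injective f ∧ ∀ y : G0, ω • y ∈ LinearMap.range f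

/-- The map induced on (componentwise) cokernels by a morphism
`(φ1, φ0) : (g : A → B) → (f : A' → B')` of the morphism category, i.e. the map
`Coker φ1 = A'/im φ1 → Coker φ0 = B'/im φ0` induced by `f`. -/
noncomputable def cokerMap {S : Type} [CommRing S] {A B A' B' : Type}
    [AddCommGroup A] [Module S A] [AddCommGroup B] [Module S B]
    [AddCommGroup A'] [Module S A'] [AddCommGroup B'] [Module S B']
    (g : A →ₗ[S] B) (f : A' →ₗ[S] B') (φ1 : A →ₗ[S] A') (φ0 : B →ₗ[S] B')
    (hcomm : f ∘ₗ φ1 = φ0 ∘ₗ g) :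
    (A' ⧸ LinearMap.range φ1) →ₗ[S] (B' ⧸ LinearMap.range φ0) :=
  Submodule.mapQ _ _ f (by
    rintro _ ⟨x, rfl⟩
    exact ⟨g x, (LinearMap.congr_fun hcomm x).symm⟩)


theorem oldExt_iff {A : Type} [CommRing A] (X Y : ModuleCat.{0} A) (P : ProjectiveResolution X) (n : ℕ) :
    Subsingleton (((Ext A (ModuleCat A) (n+1)).obj (Opposite.op X)).obj Y) ↔
    ∀ f : P.complex.X (n+1) ⟶ Y, P.complex.d (n+2) (n+1) ≫ f = 0 →
      ∃ g : P.complex.X n ⟶ Y, P.complex.d (n+1) n ≫ g = f := by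
  rw [← ModuleCat.isZero_iff_subsingleton, (P.isoExt (R := A) (n+1) Y).isZero_iff,
    ← HomologicalComplex.exactAt_iff_isZero_homology,
    HomologicalComplex.exactAt_iff' _ n (n+1) (n+2) (by simp) (by simp),
    ShortComplex.moduleCat_exact_iff]
  rfl

theorem newExt_iff {A : Type} [CommRing A] (X Y : ModuleCat.{0} A) (P : ProjectiveResolution X) (n : ℕ) :
    Subsingleton (Abelian.Ext X Y (n+1)) ↔
    ∀ f : P.complex.X (n+1) ⟶ Y, P.complex.d (n+2) (n+1) ≫ f = 0 →
      ∃ g : P.complex.X n ⟶ Y, P.complex.d (n+1) n ≫ g = f := by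
  constructor
  · intro h f hf
    exact (P.extMk_eq_zero_iff f (n+2) rfl hf n rfl).1 (Subsingleton.elim _ _)
  · intro h
    refine subsingleton_of_forall_eq 0 fun x => ?_
    obtain ⟨f, hf, rfl⟩ := P.extMk_surjective x (n+2) rfl
    exact (P.extMk_eq_zero_iff f (n+2) rfl hf n rfl).2 (h f hf)

theorem ext_bridge {A : Type} [CommRing A] (X Y : ModuleCat.{0} A) (n : ℕ) :
    Subsingleton (((Ext A (ModuleCat A) (n+1)).obj (Opposite.op X)).obj Y) ↔
    Subsingleton (Abelian.Ext X Y (n+1)) := by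
  rw [oldExt_iff X Y (projectiveResolution X), newExt_iff X Y (projectiveResolution X)]


def EV (A : Type) [CommRing A] (M : Type) [AddCommGroup M] [Module A M] : Prop :=
  ∀ i : ℕ, Subsingleton (Abelian.Ext (ModuleCat.of A M) (ModuleCat.of A A) (i+1))

theorem isGP_iff (A : Type) [CommRing A] (M : Type) [AddCommGroup M] [Module A M] :
    IsGP A M ↔ Function.Bijective (Module.Dual.eval A M) ∧ EV A M ∧ EV A (Module.Dual A M) := by
  have key : ∀ (X : ModuleCat.{0} A), (∀ i : ℕ, 0 < i →
    Subsingleton (((Ext A (ModuleCat A) i).obj (Opposite.op X)).obj (ModuleCat.of A A))) ↔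
      ∀ i : ℕ, Subsingleton (Abelian.Ext X (ModuleCat.of A A) (i+1)) := by
    intro X
    constructor
    · intro h i
      exact (ext_bridge X _ i).1 (h (i+1) (Nat.succ_pos i))
    · intro h i hi
      obtain ⟨j, rfl⟩ : ∃ j, i = j + 1 := ⟨i - 1, by omega⟩
      exact (ext_bridge X _ j).2 (h j)
  unfold IsGP EV
  rw [key, key]

section ses
variable {A : Type} [CommRing A] {M N P : Type} [AddCommGroup M] [Module A M]
  [AddCommGroup N] [Module A N] [AddCommGroup P] [Module A P]
  (f : M →ₗ[A] N) (g : N →ₗ[A] P)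

theorem exists_ses (hf : Function.Injective f) (hg : Function.Surjective g)
    (h : Function.Exact f g) :
    ∃ w, (ShortComplex.mk (ModuleCat.ofHom f) (ModuleCat.ofHom g) w).ShortExact := by
  refine ⟨by ext x; exact h.apply_apply_eq_zero x, ?_⟩
  refine ShortComplex.ShortExact.mk' ?_ ?_ ?_
  · rw [ShortComplex.moduleCat_exact_iff]
    intro x hx
    exact (h x).1 hx
  · exact (ModuleCat.mono_iff_injective _).2 hf
  · exact (ModuleCat.epi_iff_surjective _).2 hg

theorem EV_projective [Module.Projective A M] : EV A M := fun i =>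
  Abelian.Ext.subsingleton_of_projective _ _ i

theorem EV_coker [Module.Projective A N] (hf : Function.Injective f) (hg : Function.Surjective g)
    (h : Function.Exact f g) (hM : EV A M)
    (hext : ∀ t : Module.Dual A M, ∃ k : Module.Dual A N, k ∘ₗ f = t) : EV A P := by
  obtain ⟨w, hs⟩ := exists_ses f g hf hg h
  intro i
  refine subsingleton_of_forall_eq 0 fun x => ?_
  have hx0 : (Abelian.Ext.mk₀ (ModuleCat.ofHom g)).comp x (zero_add (i+1)) = 0 :=
    Subsingleton.elim (h := EV_projective (A := A) (M := N) i) _ _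
  obtain ⟨y, hy⟩ := Abelian.Ext.contravariant_sequence_exact₃ hs (ModuleCat.of A A) x hx0
    (Nat.add_comm 1 i)
  rw [← hy]
  cases i with
  | succ j =>
    have : y = 0 := Subsingleton.elim (h := hM j) _ _
    rw [this, Abelian.Ext.comp_zero]
  | zero =>
    obtain ⟨t, rfl⟩ := (Abelian.Ext.mk₀_bijective _ _).2 y
    obtain ⟨k, hk⟩ := hext t.hom
    have : t = ModuleCat.ofHom f ≫ ModuleCat.ofHom k := by
      ext x
      exact (LinearMap.congr_fun hk x).symm
    rw [this, ← Abelian.Ext.mk₀_comp_mk₀]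
    exact hs.extClass_comp_assoc _

theorem EV_ker [Module.Projective A N] (hf : Function.Injective f) (hg : Function.Surjective g)
    (h : Function.Exact f g) (hP : EV A P) : EV A M := by
  obtain ⟨w, hs⟩ := exists_ses f g hf hg h
  intro i
  refine subsingleton_of_forall_eq 0 fun x => ?_
  obtain ⟨y, hy⟩ := Abelian.Ext.contravariant_sequence_exact₁ hs (ModuleCat.of A A) x
    (Nat.add_comm 1 (i+1)) (Subsingleton.elim (h := hP (i+1)) _ _)
  have : y = 0 := Subsingleton.elim (h := EV_projective (A := A) (M := N) i) _ _
  rw [← hy, this, Abelian.Ext.comp_zero]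

theorem extend_of_EV (hf : Function.Injective f) (hg : Function.Surjective g)
    (h : Function.Exact f g) (hP : EV A P) (t : Module.Dual A M) :
    ∃ k : Module.Dual A N, k ∘ₗ f = t := by
  obtain ⟨w, hs⟩ := exists_ses f g hf hg h
  obtain ⟨y, hy⟩ := Abelian.Ext.contravariant_sequence_exact₁ hs (ModuleCat.of A A)
    (Abelian.Ext.mk₀ (ModuleCat.ofHom t))
    (Nat.add_comm 1 0) (Subsingleton.elim (h := hP 0) _ _)
  obtain ⟨k, rfl⟩ := (Abelian.Ext.mk₀_bijective _ _).2 y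
  rw [Abelian.Ext.mk₀_comp_mk₀] at hy
  have := (Abelian.Ext.mk₀_bijective _ _).1 hy
  refine ⟨k.hom, ?_⟩
  ext x
  exact congrArg (fun u => u.hom x) this

end ses

theorem isGP_projective (A : Type) [CommRing A] (M : Type) [AddCommGroup M] [Module A M]
    [Module.Finite A M] [Module.Projective A M] : IsGP A M := by
  rw [isGP_iff]
  exact ⟨Module.bijective_dual_eval A M, EV_projective, EV_projective⟩

theorem isGP_coker {A : Type} [CommRing A] {G P : Type} [AddCommGroup G] [Module A G]
    [AddCommGroup P] [Module A P] [Module.Finite A P] [Module.Projective A P] (hG : IsGP A G)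
    (φ : G →ₗ[A] P) (hφ : Function.Injective φ)
    (hext : ∀ t : Module.Dual A G, ∃ k : Module.Dual A P, k ∘ₗ φ = t) :
    IsGP A (P ⧸ LinearMap.range φ) := by
  rw [isGP_iff] at hG ⊢
  obtain ⟨hG1, hG2, hG3⟩ := hG
  set π := (LinearMap.range φ).mkQ with hπ
  have hPr := Module.bijective_dual_eval A P
  have hπs : Function.Surjective π := Submodule.mkQ_surjective _
  have hex : Function.Exact φ π := LinearMap.exact_map_mkQ_range φ
  have hd1 : Function.Injective π.dualMap := LinearMap.dualMap_injective_of_surjective hπs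
  have hd2 : Function.Surjective φ.dualMap := fun t => hext t
  have hd3 : Function.Exact π.dualMap φ.dualMap := by
    intro k
    constructor
    · intro hk
      refine ⟨(LinearMap.range φ).liftQ k ?_, ?_⟩
      · rintro _ ⟨x, rfl⟩
        exact LinearMap.congr_fun hk x
      · ext x; rfl
    · rintro ⟨l, rfl⟩
      ext x
      change l (π (φ x)) = 0
      rw [hex.apply_apply_eq_zero, map_zero]
  refine ⟨⟨?_, ?_⟩, EV_coker φ π hφ hπs hex hG2 hext, EV_ker π.dualMap φ.dualMap hd1 hd2 hd3 hG3⟩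
  · rw [injective_iff_map_eq_zero]
    intro c hc
    obtain ⟨p, rfl⟩ := hπs c
    choose s hs using hd2
    have hwell : ∀ k k' : Module.Dual A P, φ.dualMap k = φ.dualMap k' → k p = k' p := by
      intro k k' h
      have : φ.dualMap (k - k') = 0 := by rw [map_sub, h, sub_self]
      obtain ⟨l, hl⟩ := (hd3 _).1 this
      have h2 := LinearMap.congr_fun hl p
      have h3 : l (π p) = 0 := LinearMap.congr_fun hc l
      have h4 : l (π p) = k p - k' p := h2
      rw [h3] at h4
      exact (sub_eq_zero.1 h4.symm)
    let θ : Module.Dual A (Module.Dual A G) :=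
      { toFun := fun t => s t p
        map_add' := fun t u => hwell (s (t + u)) (s t + s u) (by rw [map_add, hs, hs, hs])
        map_smul' := fun r t => hwell (s (r • t)) (r • s t) (by rw [map_smul, hs, hs]) }
    obtain ⟨x, hx⟩ := hG1.2 θ
    have : φ x = p := by
      apply hPr.1
      ext k
      have h1 : k (φ x) = s (φ.dualMap k) p := LinearMap.congr_fun hx (φ.dualMap k)
      change k (φ x) = k p
      rw [h1]
      exact hwell _ _ (hs _)
    rw [← this, hex.apply_apply_eq_zero]
  · intro θ
    obtain ⟨Θ, hΘ⟩ := extend_of_EV π.dualMap φ.dualMap hd1 hd2 hd3 hG3 θ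
    obtain ⟨p, rfl⟩ := hPr.2 Θ
    refine ⟨π p, ?_⟩
    ext l
    exact LinearMap.congr_fun hΘ l

theorem exists_approx {A : Type} [CommRing A] [IsNoetherianRing A] {G : Type} [AddCommGroup G]
    [Module A G] [Module.Finite A G] :
    ∃ (n : ℕ) (a : G →ₗ[A] (Fin n → A)),
      ∀ t : Module.Dual A G, ∃ k : Module.Dual A (Fin n → A), k ∘ₗ a = t := by
  have hfin : Module.Finite A (Module.Dual A G) := inferInstance
  obtain ⟨n, v, hv⟩ := Module.Finite.exists_fin (R := A) (M := Module.Dual A G)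
  refine ⟨n, LinearMap.pi v, fun t => ?_⟩
  have ht : t ∈ Submodule.span A (Set.range v) := hv ▸ Submodule.mem_top
  obtain ⟨c, hc⟩ := (Submodule.mem_span_range_iff_exists_fun A).1 ht
  refine ⟨∑ i, c i • LinearMap.proj i, ?_⟩
  rw [← hc]
  ext x
  simp

theorem inj_of_ext {A : Type} [CommRing A] {G P : Type} [AddCommGroup G] [Module A G]
    [AddCommGroup P] [Module A P] (hG : Function.Injective (Module.Dual.eval A G))
    (φ : G →ₗ[A] P)
    (hext : ∀ t : Module.Dual A G, ∃ k : Module.Dual A P, k ∘ₗ φ = t) : Function.Injective φ := by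
  intro x y h
  apply hG
  ext t
  obtain ⟨k, rfl⟩ := hext t
  exact congrArg k h

theorem torsionfree_of_eval {A : Type} [CommRing A] {G : Type} [AddCommGroup G] [Module A G]
    (hG : Function.Injective (Module.Dual.eval A G)) {w : A} (hw : w ∈ nonZeroDivisors A)
    {x : G} (h : w • x = 0) : x = 0 := by
  apply hG
  ext t
  have h1 : w * t x = 0 := by rw [← smul_eq_mul, ← map_smul, h, map_zero]
  simpa using (mul_left_mem_nonZeroDivisors_eq_zero_iff hw).1 h1

/-- `Mon(ω, 𝒢)` has enough injectives: every object `(g1 : G1 → G0)`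
admits an admissible monic into an injective object
`(ω ⊕ id : Q1 ⊕ Q0 → Q1 ⊕ Q0)` with `Q1, Q0` finitely generated projective. -/
theorem stmt_8 (S : Type) [CommRing S] [IsNoetherianRing S] [IsLocalRing S]
    (ω : S) (hω : ω ∈ IsLocalRing.maximalIdeal S) (hreg : ω ∈ nonZeroDivisors S)
    (G1 G0 : Type) [AddCommGroup G1] [Module S G1] [AddCommGroup G0] [Module S G0]
    (g1 : G1 →ₗ[S] G0) (hg1 : MonObj S ω g1) :
    ∃ (Q1 Q0 : ModuleCat S),
      Module.Finite S Q1 ∧ Module.Projective S Q1 ∧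
      Module.Finite S Q0 ∧ Module.Projective S Q0 ∧
      MonObj S ω ((ω • (LinearMap.id : Q1 →ₗ[S] Q1)).prodMap
          (LinearMap.id : Q0 →ₗ[S] Q0)) ∧
      ∃ (φ1 : G1 →ₗ[S] Q1 × Q0) (φ0 : G0 →ₗ[S] Q1 × Q0),
        ∃ hcomm : ((ω • (LinearMap.id : Q1 →ₗ[S] Q1)).prodMap
              (LinearMap.id : Q0 →ₗ[S] Q0)) ∘ₗ φ1 = φ0 ∘ₗ g1,
          Function.Injective φ1 ∧ Function.Injective φ0 ∧
          MonObj S ω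
            (cokerMap g1
              ((ω • (LinearMap.id : Q1 →ₗ[S] Q1)).prodMap
                (LinearMap.id : Q0 →ₗ[S] Q0)) φ1 φ0 hcomm) := by

  obtain ⟨hf1, hf0, hG1, hG0, hinj, hcok⟩ := hg1
  choose s hs using hcok
  have tf0 : ∀ x : G0, ω • x = 0 → x = 0 := fun x => torsionfree_of_eval hG0.1.1 hreg
  have tf1 : ∀ x : G1, ω • x = 0 → x = 0 := fun x => torsionfree_of_eval hG1.1.1 hreg
  let g0 : G0 →ₗ[S] G1 :=
    { toFun := s
      map_add' := fun x y => hinj (by rw [map_add, hs, hs, hs, smul_add])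
      map_smul' := fun r x => hinj (by rw [RingHom.id_apply, map_smul, hs, hs, smul_comm]) }
  have hg10 : ∀ y, g1 (g0 y) = ω • y := hs
  have hg01 : ∀ x, g0 (g1 x) = ω • x := fun x => hinj (by rw [hg10, map_smul])
  obtain ⟨n, a, ha⟩ := exists_approx (A := S) (G := G1)
  obtain ⟨m, d, hd⟩ := exists_approx (A := S) (G := G0)
  have hainj := inj_of_ext hG1.1.1 a ha
  have hdinj := inj_of_ext hG0.1.1 d hd
  have hCa := isGP_coker hG1 a hainj ha
  let φ1 : G1 →ₗ[S] (Fin n → S) × (Fin m → S) := a.prod (d ∘ₗ g1)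
  let φ0 : G0 →ₗ[S] (Fin n → S) × (Fin m → S) := (a ∘ₗ g0).prod d
  have hφ1 : ∀ t : Module.Dual S G1, ∃ k, k ∘ₗ φ1 = t := fun t => by
    obtain ⟨k, hk⟩ := ha t
    exact ⟨k ∘ₗ LinearMap.fst S _ _, hk⟩
  have hφ0 : ∀ t : Module.Dual S G0, ∃ k, k ∘ₗ φ0 = t := fun t => by
    obtain ⟨k, hk⟩ := hd t
    exact ⟨k ∘ₗ LinearMap.snd S _ _, hk⟩
  have hi1 := inj_of_ext hG1.1.1 φ1 hφ1
  have hi0 := inj_of_ext hG0.1.1 φ0 hφ0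
  have hcomm : ((ω • (LinearMap.id : (Fin n → S) →ₗ[S] (Fin n → S))).prodMap
      (LinearMap.id : (Fin m → S) →ₗ[S] (Fin m → S))) ∘ₗ φ1 = φ0 ∘ₗ g1 := by
    refine LinearMap.ext fun x => ?_
    change ((ω • a x, d (g1 x)) : (Fin n → S) × (Fin m → S)) = (a (g0 (g1 x)), d (g1 x))
    rw [hg01, map_smul]
  refine ⟨ModuleCat.of S (Fin n → S), ModuleCat.of S (Fin m → S),
    inferInstanceAs (Module.Finite S (Fin n → S)), inferInstanceAs (Module.Projective S (Fin n → S)),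
    inferInstanceAs (Module.Finite S (Fin m → S)), inferInstanceAs (Module.Projective S (Fin m → S)),
    ?_, φ1, φ0, hcomm, hi1, hi0, ?_⟩
  · refine ⟨inferInstanceAs (Module.Finite S ((Fin n → S) × (Fin m → S))),
      inferInstanceAs (Module.Finite S ((Fin n → S) × (Fin m → S))),
      isGP_projective S ((Fin n → S) × (Fin m → S)),
      isGP_projective S ((Fin n → S) × (Fin m → S)), ?_, ?_⟩
    · rw [injective_iff_map_eq_zero]
      rintro ⟨x, y⟩ h
      have h1 : ω • x = 0 := congrArg Prod.fst h
      have h2 : y = 0 := congrArg Prod.snd h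
      have h3 : x = 0 :=
        torsionfree_of_eval (isGP_projective S (Fin n → S)).1.1 hreg h1
      exact Prod.ext h3 h2
    · rintro ⟨x, y⟩
      exact ⟨(x, ω • y), rfl⟩
  · refine ⟨inferInstanceAs (Module.Finite S (((Fin n → S) × (Fin m → S)) ⧸ LinearMap.range φ1)),
      inferInstanceAs (Module.Finite S (((Fin n → S) × (Fin m → S)) ⧸ LinearMap.range φ0)),
      isGP_coker hG1 φ1 hi1 hφ1, isGP_coker hG0 φ0 hi0 hφ0, ?_, ?_⟩
    · rw [injective_iff_map_eq_zero]
      intro c hc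
      obtain ⟨⟨x, y⟩, rfl⟩ := Submodule.mkQ_surjective _ c
      obtain ⟨z, hz⟩ := (Submodule.Quotient.mk_eq_zero (LinearMap.range φ0)).1 hc
      have h1 : a (g0 z) = ω • x := congrArg Prod.fst hz
      have h2 : d z = y := congrArg Prod.snd hz
      have h3 : (LinearMap.range a).mkQ x = 0 := by
        apply torsionfree_of_eval hCa.1.1 hreg
        rw [← map_smul, ← h1]
        exact (Submodule.Quotient.mk_eq_zero _).2 ⟨_, rfl⟩
      obtain ⟨w, hw⟩ := (Submodule.Quotient.mk_eq_zero _).1 h3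
      have h4 : g0 z = ω • w := hainj (by rw [h1, map_smul, hw])
      have h5 : z = g1 w := by
        have : ω • (z - g1 w) = 0 := by
          rw [smul_sub, ← hg10, h4, map_smul, sub_self]
        exact sub_eq_zero.1 (tf0 _ this)
      refine (Submodule.Quotient.mk_eq_zero (LinearMap.range φ1)).2 ⟨w, ?_⟩
      refine Prod.ext hw ?_
      change d (g1 w) = y
      rw [← h5, h2]
    · intro c
      obtain ⟨⟨x, y⟩, rfl⟩ := Submodule.mkQ_surjective _ c
      exact ⟨(LinearMap.range φ1).mkQ (x, ω • y), rfl⟩
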